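/- Let 𝒫 be a graded poset for which there exists an adequate local covering family and a global covering family 𝒦. Then there exists a co-chain complex 0 → B_0^𝒦 → B_1^𝒦 → B_2^𝒦 → …, with each B_n^𝒦 a free abelian group of rank b_n^𝒦 and differentials Ω_n induced by the differentials d_n, whose cohomology is H^*(𝒫; ℤ). -/

import Mathlib

open Finset

/-- A graded poset (with the standing assumptions of Remark 2.5: the degree function is
order-reversing, adds one along preceding pairs, takes nonnegative values, and every
up-set is finite). -/
structure GradedPoset (P : Type) [PartialOrder P] : Type where
  deg : P → ℤ
  deg_antitone : ∀ ⦃p q : P⦄, p ≤ q → deg q ≤ deg p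
  deg_step : ∀ ⦃p q : P⦄, p < q → (∀ r, p ≤ r → r ≤ q → r = p ∨ r = q) → deg p = deg q + 1
  deg_nonneg : ∀ p, 0 ≤ deg p
  finite_up : ∀ p : P, {q : P | p ≤ q}.Finite

/-- A functor from a poset `P` to the category `Ab` of abelian groups. -/
structure PosetFunctor (P : Type) [PartialOrder P] : Type 1 where
  obj : P → Type
  grp : ∀ p, AddCommGroup (obj p)
  map : ∀ {p q : P}, p ≤ q → obj p →+ obj q
  map_id : ∀ (p : P) (x : obj p), map (le_refl p) x = x
  map_comp : ∀ {p q r : P} (h₁ : p ≤ q) (h₂ : q ≤ r) (x : obj p),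
    map h₂ (map h₁ x) = map (h₁.trans h₂) x

attribute [instance] PosetFunctor.grp

variable {P : Type} [PartialOrder P]

/-- A natural transformation between functors `P → Ab`. -/
structure PosetHom (F G : PosetFunctor P) : Type where
  app : ∀ p : P, F.obj p →+ G.obj p
  naturality : ∀ {p q : P} (h : p ≤ q) (x : F.obj p),
    G.map h (app p x) = app q (F.map h x)

/-- The constant functor with value `ℤ`. -/
def constZ (P : Type) [PartialOrder P] : PosetFunctor P where
  obj _ := ℤ
  grp _ := inferInstance
  map _ := AddMonoidHom.id ℤ
  map_id _ _ := rfl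
  map_comp _ _ _ := rfl

namespace PosetFunctor

/-- The inverse limit `lim F` of `F : P → Ab`, realized as the group of compatible
families (sections). -/
def sections (F : PosetFunctor P) : AddSubgroup (∀ p, F.obj p) where
  carrier := {x | ∀ (p q : P) (h : p ≤ q), F.map h (x p) = x q}
  zero_mem' := by intro p q h; simp
  add_mem' := by intro a b ha hb p q h; simp [map_add, ha p q h, hb p q h]
  neg_mem' := by intro a ha p q h; simp [ha p q h]

/-- The functor `F'` with `F'(p₀) = ∏_{p₀ ≤ p} F(p)`; a morphism `p₁ ≤ p₀` acts by
sending the factor indexed by `p₁ ≤ p` identically to the factor indexed by `p₀ ≤ p`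
when `p₀ ≤ p`, and by zero otherwise. -/
def prime (F : PosetFunctor P) : PosetFunctor P where
  obj p₀ := ∀ q : {q : P // p₀ ≤ q}, F.obj q.1
  grp _ := inferInstance
  map h := AddMonoidHom.mk' (fun x q => x ⟨q.1, h.trans q.2⟩) (fun _ _ => rfl)
  map_id _ _ := rfl
  map_comp _ _ _ := rfl

end PosetFunctor

/-- The subgroup `Ker_F(p₀) = ⋂_{p₀ < q} Ker (F(p₀ → q))`. -/
def kerAt (F : PosetFunctor P) (p₀ : P) : AddSubgroup (F.obj p₀) where
  carrier := {x | ∀ (q : P) (h : p₀ < q), F.map h.le x = 0}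
  zero_mem' := by intro q h; simp
  add_mem' := by intro a b ha hb q h; simp [map_add, ha q h, hb q h]
  neg_mem' := by intro a ha q h; simp [ha q h]

/-- `F` is `n`-condensed: `F(p) = 0` for `deg p < n` and `Ker_F(p) = 0` for `deg p > n`. -/
def IsCondensed (G : GradedPoset P) (F : PosetFunctor P) (n : ℕ) : Prop :=
  (∀ p : P, G.deg p < (n : ℤ) → ∀ x : F.obj p, x = 0) ∧
  (∀ p : P, (n : ℤ) < G.deg p → ∀ x ∈ kerAt F p, x = 0)

/-- The set `(p₀ ↓ P)_n` of objects above `p₀` of degree `n`. -/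
def degSet (G : GradedPoset P) (p₀ : P) (n : ℕ) : Set P :=
  {q : P | p₀ ≤ q ∧ G.deg q = (n : ℤ)}

/-- The functor `Ker'_F` (for an `n`-condensed functor `F`):
`Ker'_F(p₀) = ∏_{p ∈ (p₀↓P)_n} F(p)`. -/
def kerPrime (G : GradedPoset P) (F : PosetFunctor P) (n : ℕ) : PosetFunctor P where
  obj p₀ := ∀ q : degSet G p₀ n, F.obj q.1
  grp _ := inferInstance
  map h := AddMonoidHom.mk' (fun x q => x ⟨q.1, h.trans q.2.1, q.2.2⟩) (fun _ _ => rfl)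
  map_id _ _ := rfl
  map_comp _ _ _ := rfl

/-- The natural transformation `λ : F ⇒ Ker'_F` with components
`λ_{p₀} = ∏_{p ∈ (p₀↓P)_n} F(p₀ → p)`. -/
def lambdaNT (G : GradedPoset P) (F : PosetFunctor P) (n : ℕ) :
    PosetHom F (kerPrime G F n) where
  app p₀ := AddMonoidHom.mk' (fun x q => F.map q.2.1 x)
    (by intro a b; funext q; exact map_add _ a b)
  naturality := by
    intro p q h x
    funext r
    exact (F.map_comp h r.2.1 x).symm

/-! ### The cochain complex computing higher inverse limits -/

/-- Composable chains `p₀ ≤ p₁ ≤ … ≤ pₙ` in `P`. -/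
def ChainP (P : Type) [PartialOrder P] (n : ℕ) : Type :=
  {c : Fin (n + 1) → P // Monotone c}

/-- `n`-cochains of the cobar complex computing the derived functors of `lim` over `P`
with coefficients in `F`. -/
abbrev cochain (F : PosetFunctor P) (n : ℕ) : Type :=
  ∀ c : ChainP P n, F.obj (c.1 (Fin.last n))

/-- The `i`-th face of a chain. -/
def chainFace {n : ℕ} (i : Fin (n + 2)) (c : ChainP P (n + 1)) : ChainP P n :=
  ⟨c.1 ∘ i.succAbove, c.2.comp (Fin.strictMono_succAbove i).monotone⟩

/-- The differential of the cobar complex. -/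
noncomputable def cobarDiff (F : PosetFunctor P) (n : ℕ) : cochain F n →+ cochain F (n + 1) :=
  AddMonoidHom.mk'
    (fun ψ c => ∑ i : Fin (n + 2),
      ((-1 : ℤ) ^ (i : ℕ)) • F.map (c.2 (Fin.le_last (i.succAbove (Fin.last n))))
        (ψ (chainFace i c)))
    (by
      intro a b; funext c
      simp only [Pi.add_apply, map_add, smul_add]
      refine Eq.trans (Finset.sum_congr rfl fun i _ => ?_) (Finset.sum_add_distrib (s := Finset.univ)
        (f := fun i : Fin (n + 2) => ((-1 : ℤ) ^ (i : ℕ)) •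
          F.map (c.2 (Fin.le_last (i.succAbove (Fin.last n)))) (a (chainFace i c)))
        (g := fun i : Fin (n + 2) => ((-1 : ℤ) ^ (i : ℕ)) •
          F.map (c.2 (Fin.le_last (i.succAbove (Fin.last n)))) (b (chainFace i c))))
      exact (congrArg (fun y => ((-1 : ℤ) ^ (i : ℕ)) • y)
        (map_add (F.map (c.2 (Fin.le_last (i.succAbove (Fin.last n))))) (a (chainFace i c))
          (b (chainFace i c)))).trans (smul_add _ _ _))

/-- Coboundaries of the cobar complex. -/
noncomputable def cobarCoboundaries (F : PosetFunctor P) : ∀ n : ℕ, AddSubgroup (cochain F n)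
  | 0 => ⊥
  | n + 1 => (cobarDiff F n).range

/-- `H^n(P; F) = lim^n F`, the cohomology of `P` with coefficients in `F`, computed by
the cobar complex. -/
noncomputable def cohomologyOf (F : PosetFunctor P) (n : ℕ) : Type :=
  (cobarDiff F n).ker ⧸ ((cobarCoboundaries F n).addSubgroupOf (cobarDiff F n).ker)

noncomputable instance (F : PosetFunctor P) (n : ℕ) : AddCommGroup (cohomologyOf F n) :=
  inferInstanceAs (AddCommGroup (_ ⧸ _))

/-- The `n`-th Betti number of `P` with coefficients in `F`: the rank of `H^n(P;F)`. -/
noncomputable def bettiOf (F : PosetFunctor P) (n : ℕ) : ℕ :=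
  Module.finrank ℤ (cohomologyOf F n)

/-! ### Free functors, pure maps, local covering families -/

/-- A functor is free if all its values are finitely generated free abelian groups. -/
def IsFreeFunctor (F : PosetFunctor P) : Prop :=
  ∀ p : P, Module.Free ℤ (F.obj p) ∧ Module.Finite ℤ (F.obj p)

/-- A map of abelian groups is pure if its cokernel is a free abelian group. -/
def IsPureHom {A B : Type} [AddCommGroup A] [AddCommGroup B] (f : A →+ B) : Prop :=
  Module.Free ℤ (B ⧸ f.range)

/-- Sections of `F` over a subset `S ⊆ P`, i.e. `lim_S F`. -/
def sectionsOnSet (F : PosetFunctor P) (S : Set P) : Set (∀ q : S, F.obj q.1) :=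
  {x | ∀ (q r : S) (h : q.1 ≤ r.1), F.map h (x q) = x r}

/-- The restriction map `lim_{(p₀↓P)_*} F → ∏_{q ∈ S} F(q)` (for `S` a set of objects
strictly above `p₀`, realized by intersecting with `{q | p₀ < q}`). -/
def limRestriction (F : PosetFunctor P) (p₀ : P) (S : Set P) :
    ↥(sectionsOnSet F {q : P | p₀ < q}) → ∀ q : ↥(S ∩ {q : P | p₀ < q}), F.obj q.1 :=
  fun x q => x.1 ⟨q.1, q.2.2⟩

/-- The map `F(p₀) → ∏_{q ∈ S} F(q)` (for `S` a set of objects above `p₀`, realized by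
intersecting with `{q | p₀ ≤ q}`). -/
def detMap (F : PosetFunctor P) (p₀ : P) (S : Set P) :
    F.obj p₀ →+ ∀ q : ↥(S ∩ {q : P | p₀ ≤ q}), F.obj q.1 :=
  AddMonoidHom.mk' (fun x q => F.map q.2.2 x) (by intro a b; funext q; exact map_add _ a b)

/-- A local covering family `𝒥 = {J_n^{p₀}}` (Definition 3.4). -/
def IsLCF (G : GradedPoset P) (J : P → ℕ → Set P) : Prop :=
  (∀ (p : P) (m : ℕ), J p m ⊆ degSet G p m) ∧
  (∀ (p : P) (m : ℕ), (m : ℤ) < G.deg p →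
    (⋃ r ∈ J p (m + 1), degSet G r m) = degSet G p m) ∧
  (∀ (p : P) (m : ℕ), ∀ r ∈ J p (m + 1), J r m ⊆ J p m)

/-- `F` (an `n`-condensed free functor) is `𝒥`-determined (Definition 3.5). -/
def IsDetermined (G : GradedPoset P) (J : P → ℕ → Set P) (F : PosetFunctor P) (n : ℕ) :
    Prop :=
  (∀ p₀ : P, (n : ℤ) + 1 < G.deg p₀ →
    Function.Injective (limRestriction F p₀ (J p₀ n)) ∧ IsPureHom (detMap F p₀ (J p₀ n))) ∧
  (∀ p₀ : P, G.deg p₀ = (n : ℤ) + 1 →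
    IsPureHom (detMap F p₀ (J p₀ n)) ∧ Function.Injective (detMap F p₀ (J p₀ n)))

/-- The finite set `(p↓P)_n`. -/
noncomputable def degFinset (G : GradedPoset P) (p : P) (n : ℕ) : Finset P :=
  ((G.finite_up p).subset
    (show degSet G p n ⊆ {q : P | p ≤ q} from fun _ hq => hq.1)).toFinset

/-- The numbers `R_n^{p₀}` (Definition 4.1). -/
noncomputable def Rnum (G : GradedPoset P) : ℕ → P → ℤ
  | 0, _ => 1
  | m + 1, p => (∑ q ∈ degFinset G p m, Rnum G m q) - Rnum G m p

/-- The finite set `J_n^p` (as a `Finset`, using finiteness of up-sets). -/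
noncomputable def JFinset (G : GradedPoset P) (J : P → ℕ → Set P) (p : P) (n : ℕ) :
    Finset P :=
  ((G.finite_up p).inter_of_left (J p n)).toFinset

/-- Connectedness of a subset of a poset, viewed as a full subcategory. -/
def IsConnectedSet (S : Set P) : Prop :=
  S.Nonempty ∧ ∀ a b : S, Relation.ReflTransGen (fun x y : S => x.1 ≤ y.1 ∨ y.1 ≤ x.1) a b

/-- An adequate local covering family (Definition 4.2). -/
def IsAdequate (G : GradedPoset P) (J : P → ℕ → Set P) : Prop :=
  IsLCF G J ∧
  (∀ p : P, 2 ≤ G.deg p → IsConnectedSet {q : P | p < q}) ∧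
  (∀ (m : ℕ) (p : P), (m : ℤ) + 1 ≤ G.deg p →
    Rnum G m p = ∑ q ∈ JFinset G J p m, Rnum G m q)

/-! ### The global complex and global covering families -/

/-- Restriction of a product of abelian groups to a subset of the index set. -/
def restrictTo {ι : Type} {A : ι → Type} [∀ i, AddCommGroup (A i)] (S : Set ι) :
    (∀ i, A i) →+ ∀ i : S, A i.1 :=
  AddMonoidHom.mk' (fun x i => x i.1) (fun _ _ => rfl)

open Classical in
/-- Extension by zero of a family indexed by a subset of the index set. -/
noncomputable def extendZero {ι : Type} {A : ι → Type} [∀ i, AddCommGroup (A i)]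
    (S : Set ι) : (∀ i : S, A i.1) →+ ∀ i, A i :=
  AddMonoidHom.mk' (fun x i => if h : i ∈ S then x ⟨i, h⟩ else 0)
    (by intro a b; funext i; by_cases h : i ∈ S <;> simp [h])

/-- The map on full products induced by a natural transformation
`π : Ker'_F ⇒ F'` (the building block of the differential `d = ι ∘ ω`). -/
noncomputable def dhat (G : GradedPoset P) {F F' : PosetFunctor P} (n : ℕ)
    (π : PosetHom (kerPrime G F n) F') : (∀ p : P, F.obj p) →+ ∀ p : P, F'.obj p :=
  AddMonoidHom.mk' (fun x p => π.app p (fun q => x q.1))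
    (by intro a b; funext p; exact map_add (π.app p) _ _)

/-- The set `Ob_n(P)` of objects of degree `n`. -/
def obSet (G : GradedPoset P) (n : ℕ) : Set P := {p : P | G.deg p = (n : ℤ)}

/-- The differential `d_n = ι_{n+1} ∘ ω_{n+1} : ∏_{Ob_n} F_n(p) → ∏_{Ob_{n+1}} F_{n+1}(p)`. -/
noncomputable def obDiff (G : GradedPoset P) (F : ℕ → PosetFunctor P)
    (π : ∀ n : ℕ, PosetHom (kerPrime G (F n) n) (F (n + 1))) (n : ℕ) :
    (∀ p : ↥(obSet G n), (F n).obj p.1) →+ ∀ p : ↥(obSet G (n + 1)), (F (n + 1)).obj p.1 :=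
  (restrictTo (obSet G (n + 1))).comp ((dhat G n (π n)).comp (extendZero (obSet G n)))

/-- The composite `∏_{p ∈ Ob_n(P)∖K_n} F_n(p) → ∏_{p ∈ K_{n+1}} F_{n+1}(p)`
induced by the differential. -/
noncomputable def wMap (G : GradedPoset P) (F : ℕ → PosetFunctor P)
    (π : ∀ n : ℕ, PosetHom (kerPrime G (F n) n) (F (n + 1))) (K : ℕ → Set P) (n : ℕ) :
    (∀ p : ↥(obSet G n \ K n), (F n).obj p.1) →+ ∀ p : ↥(K (n + 1)), (F (n + 1)).obj p.1 :=
  (restrictTo (K (n + 1))).comp ((dhat G n (π n)).comp (extendZero (obSet G n \ K n)))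

/-- A global covering family (Definition 5.1). -/
def IsGCF (G : GradedPoset P) (F : ℕ → PosetFunctor P)
    (π : ∀ n : ℕ, PosetHom (kerPrime G (F n) n) (F (n + 1))) (K : ℕ → Set P) : Prop :=
  (∀ n : ℕ, K n ⊆ obSet G n) ∧
  (∀ n : ℕ, Function.Injective
    (fun (s : ↥(PosetFunctor.sections (F n))) => (fun p : ↥(K n) => s.1 p.1))) ∧
  (∀ n : ℕ, IsPureHom (wMap G F π K n))

/-- `Ob_n(P)` as a `Finset` (given that each degree level is finite). -/
noncomputable def obFinset (G : GradedPoset P)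
    (hfin : ∀ i : ℤ, {p : P | G.deg p = i}.Finite) (n : ℕ) : Finset P :=
  (hfin (n : ℤ)).toFinset

/-- `K_n` as a `Finset`. -/
noncomputable def KFinset (G : GradedPoset P)
    (hfin : ∀ i : ℤ, {p : P | G.deg p = i}.Finite) (K : ℕ → Set P) (n : ℕ) : Finset P :=
  ((hfin (n : ℤ)).inter_of_left (K n)).toFinset

/-- The Betti numbers `b_n^𝒦` of a global covering family (Definition 5.2). -/
noncomputable def bettiK (G : GradedPoset P)
    (hfin : ∀ i : ℤ, {p : P | G.deg p = i}.Finite) (K : ℕ → Set P) : ℕ → ℤ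
  | 0 => ∑ p ∈ KFinset G hfin K 0, Rnum G 0 p
  | n + 1 =>
      (∑ p ∈ KFinset G hfin K n, Rnum G n p) - (∑ p ∈ obFinset G hfin n, Rnum G n p) +
        ∑ p ∈ KFinset G hfin K (n + 1), Rnum G (n + 1) p

/-- The sequence of functors `F_0 = c_ℤ, F_1, F_2, …` of Proposition 4.3, together with
the connecting short exact sequences `0 → F_{n-1} → Ker'_{F_{n-1}} → F_n → 0` and all
their properties. -/
structure CondensedSequence (G : GradedPoset P) (J : P → ℕ → Set P) : Type 1 where
  F : ℕ → PosetFunctor P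
  pi : ∀ n : ℕ, PosetHom (kerPrime G (F n) n) (F (n + 1))
  F_zero : F 0 = constZ P
  pi_surj : ∀ (n : ℕ) (p : P), Function.Surjective ((pi n).app p)
  pi_ker : ∀ (n : ℕ) (p : P), ((pi n).app p).ker = ((lambdaNT G (F n) n).app p).range
  condensed : ∀ n : ℕ, IsCondensed G (F n) n
  free : ∀ n : ℕ, IsFreeFunctor (F n)
  determined : ∀ n : ℕ, IsDetermined G J (F n) n
  rank_eq : ∀ (n : ℕ) (p : P), (n : ℤ) ≤ G.deg p →
    (Module.finrank ℤ ((F n).obj p) : ℤ) = Rnum G n p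

/-! ### Simplex-like posets -/

/-- The poset `Δ_n` of faces of the standard `n`-dimensional simplex, ordered by
inclusion: faces are the nonempty subsets of the vertex set. -/
def SimplexPoset (n : ℕ) : Type := {s : Finset (Fin (n + 1)) // s.Nonempty}

instance (n : ℕ) : PartialOrder (SimplexPoset n) := Subtype.partialOrder _

/-- A poset `P` is simplex-like (with dimension function `d`) if for every `p` the
category `(P ↓ p)` is isomorphic to `Δ_{d p}`. -/
def SimplexLike (P : Type) [PartialOrder P] (d : P → ℕ) : Prop :=
  ∀ p : P, Nonempty ({q : P // q ≤ p} ≃o SimplexPoset (d p))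

/-- The map `∏_{p ∈ K_n} F_n(p) → ∏_{p ∈ K_{n+1}} F_{n+1}(p)` induced by the
differential `d_n`. -/
noncomputable def dK {P : Type} [PartialOrder P] (G : GradedPoset P)
    (F : ℕ → PosetFunctor P) (π : ∀ n : ℕ, PosetHom (kerPrime G (F n) n) (F (n + 1)))
    (K : ℕ → Set P) (n : ℕ) :
    (∀ p : ↥(K n), (F n).obj p.1) →+ ∀ p : ↥(K (n + 1)), (F (n + 1)).obj p.1 :=
  (restrictTo (K (n + 1))).comp ((dhat G n (π n)).comp (extendZero (K n)))

/-- The groups `B_n^𝒦`: `B_0^𝒦 = ∏_{p ∈ K_0} F_0(p)` and, for `n ≥ 1`, `B_n^𝒦` is the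
cokernel of the pure monomorphism `∏_{p ∈ Ob_{n−1}𝒫∖K_{n−1}} F_{n−1}(p) → ∏_{p ∈ K_n} F_n(p)`. -/
noncomputable def BK {P : Type} [PartialOrder P] (G : GradedPoset P)
    (F : ℕ → PosetFunctor P) (π : ∀ n : ℕ, PosetHom (kerPrime G (F n) n) (F (n + 1)))
    (K : ℕ → Set P) : ℕ → Type
  | 0 => ∀ p : ↥(K 0), (F 0).obj p.1
  | n + 1 => (∀ p : ↥(K (n + 1)), (F (n + 1)).obj p.1) ⧸ (wMap G F π K n).range

noncomputable instance {P : Type} [PartialOrder P] (G : GradedPoset P)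
    (F : ℕ → PosetFunctor P) (π : ∀ n : ℕ, PosetHom (kerPrime G (F n) n) (F (n + 1)))
    (K : ℕ → Set P) : ∀ n : ℕ, AddCommGroup (BK G F π K n)
  | 0 => inferInstanceAs (AddCommGroup (∀ p : ↥(K 0), (F 0).obj p.1))
  | n + 1 => inferInstanceAs (AddCommGroup
      ((∀ p : ↥(K (n + 1)), (F (n + 1)).obj p.1) ⧸ (wMap G F π K n).range))

namespace T55

theorem equiv_of_ker {Z A B : Type} [AddCommGroup Z] [AddCommGroup A] [AddCommGroup B]
    (f : Z →+ A) (g : Z →+ B) (hf : Function.Surjective f) (hg : Function.Surjective g)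
    (h : ∀ z, f z = 0 ↔ g z = 0) : Nonempty (A ≃+ B) := by
  have hk : f.ker = g.ker := by
    ext z; simpa [AddMonoidHom.mem_ker] using h z
  exact ⟨((QuotientAddGroup.quotientKerEquivOfSurjective f hf).symm.trans
    (QuotientAddGroup.quotientAddEquivOfEq hk)).trans
      (QuotientAddGroup.quotientKerEquivOfSurjective g hg)⟩

theorem connecting {A0 A1 A2 B0 B1 B2 C0 C1 : Type} [AddCommGroup A0] [AddCommGroup A1]
    [AddCommGroup A2] [AddCommGroup B0] [AddCommGroup B1] [AddCommGroup B2] [AddCommGroup C0]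
    [AddCommGroup C1]
    (dA0 : A0 →+ A1) (dA1 : A1 →+ A2) (dB0 : B0 →+ B1) (dB1 : B1 →+ B2) (dC0 : C0 →+ C1)
    (f0 : A0 →+ B0) (f1 : A1 →+ B1) (f2 : A2 →+ B2) (g0 : B0 →+ C0) (g1 : B1 →+ C1)
    (hf1 : Function.Injective f1) (hf2 : Function.Injective f2)
    (hg0 : Function.Surjective g0)
    (ex0 : ∀ b, g0 b = 0 ↔ ∃ a, f0 a = b)
    (ex1 : ∀ b, g1 b = 0 ↔ ∃ a, f1 a = b)
    (hdB : ∀ b, dB1 (dB0 b) = 0)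
    (cf0 : ∀ a, f1 (dA0 a) = dB0 (f0 a)) (cf1 : ∀ a, f2 (dA1 a) = dB1 (f1 a))
    (cg0 : ∀ b, g1 (dB0 b) = dC0 (g0 b))
    (exB : ∀ b, dB1 b = 0 → ∃ b', dB0 b' = b) :
    Nonempty ((dC0.ker ⧸ (dB0.ker.map g0).addSubgroupOf dC0.ker) ≃+
      (dA1.ker ⧸ dA0.range.addSubgroupOf dA1.ker)) := by
  let Z : AddSubgroup (B0 × A1) :=
    (dB0.comp (AddMonoidHom.fst B0 A1)).eqLocus (f1.comp (AddMonoidHom.snd B0 A1))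
  have hZ : ∀ z : Z, dB0 z.1.1 = f1 z.1.2 := fun z => z.2
  let u : Z →+ dC0.ker := AddMonoidHom.codRestrict (g0.comp ((AddMonoidHom.fst B0 A1).comp Z.subtype))
    dC0.ker (fun z => by
      change dC0 (g0 z.1.1) = 0
      rw [← cg0, hZ z, ex1]; exact ⟨_, rfl⟩)
  let v : Z →+ dA1.ker := AddMonoidHom.codRestrict ((AddMonoidHom.snd B0 A1).comp Z.subtype)
    dA1.ker (fun z => by
      change dA1 z.1.2 = 0
      apply hf2
      rw [cf1, ← hZ z, hdB, map_zero])
  have hu : ∀ z, (u z).1 = g0 z.1.1 := fun _ => rfl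
  have hv : ∀ z, (v z).1 = z.1.2 := fun _ => rfl
  refine equiv_of_ker ((QuotientAddGroup.mk' _).comp u) ((QuotientAddGroup.mk' _).comp v) ?_ ?_ ?_
  · intro x
    obtain ⟨c, rfl⟩ := QuotientAddGroup.mk'_surjective _ x
    obtain ⟨b, hb⟩ := hg0 c.1
    have : g1 (dB0 b) = 0 := by rw [cg0, hb]; exact c.2
    obtain ⟨a, ha⟩ := (ex1 _).1 this
    refine ⟨⟨(b, a), ha.symm⟩, ?_⟩
    change QuotientAddGroup.mk' _ (u _) = _
    congr 1
    exact Subtype.ext hb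
  · intro x
    obtain ⟨a, rfl⟩ := QuotientAddGroup.mk'_surjective _ x
    have : dB1 (f1 a.1) = 0 := by rw [← cf1, show dA1 a.1 = 0 from a.2, map_zero]
    obtain ⟨b, hb⟩ := exB _ this
    exact ⟨⟨(b, a.1), hb⟩, rfl⟩
  · intro z
    change (QuotientAddGroup.mk (u z) : dC0.ker ⧸ _) = 0 ↔
      (QuotientAddGroup.mk (v z) : dA1.ker ⧸ _) = 0
    rw [QuotientAddGroup.eq_zero_iff, QuotientAddGroup.eq_zero_iff,
      AddSubgroup.mem_addSubgroupOf, AddSubgroup.mem_addSubgroupOf, hu, hv]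
    constructor
    · rintro ⟨b, hb, hbz⟩
      have : g0 (z.1.1 - b) = 0 := by rw [map_sub, hbz, sub_self]
      obtain ⟨a, ha⟩ := (ex0 _).1 this
      refine ⟨a, hf1 ?_⟩
      rw [cf0, ha, map_sub, show dB0 b = 0 from hb, sub_zero, hZ]
    · rintro ⟨a, ha⟩
      refine ⟨z.1.1 - f0 a, ?_, ?_⟩
      · change dB0 _ = 0
        rw [map_sub, hZ, ← cf0, ha, sub_self]
      · rw [map_sub, (ex0 (f0 a)).2 ⟨a, rfl⟩, sub_zero]

variable {P : Type} [PartialOrder P]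

/-- push a cochain value to `q`. -/
noncomputable def push (F : PosetFunctor P) {n : ℕ} (ψ : cochain F n) (q : P) (c : ChainP P n) :
    F.obj q := by
  classical
  exact if h : c.1 (Fin.last n) ≤ q then F.map h (ψ c) else 0

theorem push_of (F : PosetFunctor P) {n : ℕ} (ψ : cochain F n) (q : P) (c : ChainP P n)
    (h : c.1 (Fin.last n) ≤ q) : push F ψ q c = F.map h (ψ c) := by
  simp [push, h]

theorem push_last (F : PosetFunctor P) {n : ℕ} (ψ : cochain F n) (c : ChainP P n) :
    push F ψ (c.1 (Fin.last n)) c = ψ c := by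
  rw [push_of F ψ _ c le_rfl, F.map_id]

theorem cobar_apply (F : PosetFunctor P) {n : ℕ} (ψ : cochain F n) (c : ChainP P (n + 1)) :
    cobarDiff F n ψ c = ∑ i : Fin (n + 2), ((-1 : ℤ) ^ (i : ℕ)) •
      push F ψ (c.1 (Fin.last (n + 1))) (chainFace i c) := by
  have h0 : cobarDiff F n ψ c = ∑ i : Fin (n + 2), ((-1 : ℤ) ^ (i : ℕ)) •
      F.map (c.2 (Fin.le_last (i.succAbove (Fin.last n)))) (ψ (chainFace i c)) := rfl
  rw [h0]
  refine Finset.sum_congr rfl fun i _ => ?_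
  rw [push_of F ψ _ (chainFace i c) (c.2 (Fin.le_last (i.succAbove (Fin.last n))))]
  rfl

theorem push_cobar (F : PosetFunctor P) {n : ℕ} (ψ : cochain F n) (c : ChainP P (n + 1)) (q : P)
    (h : c.1 (Fin.last (n + 1)) ≤ q) :
    push F (cobarDiff F n ψ) q c = ∑ i : Fin (n + 2), ((-1 : ℤ) ^ (i : ℕ)) •
      push F ψ q (chainFace i c) := by
  rw [push_of F _ q c h, cobar_apply, map_sum (F.map h)]
  refine Finset.sum_congr rfl fun i _ => ?_
  have h1 : (chainFace i c).1 (Fin.last n) ≤ c.1 (Fin.last (n + 1)) :=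
    c.2 (Fin.le_last (i.succAbove (Fin.last n)))
  rw [map_zsmul, push_of F ψ _ _ h1, push_of F ψ _ _ (h1.trans h), F.map_comp]

theorem chainFace_comm {n : ℕ} (c : ChainP P (n + 2)) (i : Fin (n + 3)) (j : Fin (n + 2)) :
    chainFace j (chainFace i c) = chainFace (j.predAbove i) (chainFace (i.succAbove j) c) := by
  apply Subtype.ext
  funext k
  change c.1 _ = c.1 _
  rw [Fin.succAbove_succAbove_succAbove_predAbove]

theorem alt_sum_zero {A : Type} [AddCommGroup A] {n : ℕ} (t : ChainP P n → A)
    (c : ChainP P (n + 2)) :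
    ∑ i : Fin (n + 3), ((-1 : ℤ) ^ (i : ℕ)) • ∑ j : Fin (n + 2), ((-1 : ℤ) ^ (j : ℕ)) •
      t (chainFace j (chainFace i c)) = 0 := by
  simp only [Finset.smul_sum, smul_smul, ← pow_add]
  rw [← Finset.sum_product', Finset.univ_product_univ]
  refine Finset.sum_involution (fun ij _ => (ij.1.succAbove ij.2, ij.2.predAbove ij.1)) ?_ ?_ ?_ ?_
  · rintro ⟨i, j⟩ -
    dsimp only
    rw [Fin.neg_one_pow_succAbove_add_predAbove, ← chainFace_comm, neg_smul, add_neg_cancel]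
  · rintro ⟨i, j⟩ - - h
    exact Fin.succAbove_ne i j (congrArg Prod.fst h)
  · intros; exact Finset.mem_univ _
  · rintro ⟨i, j⟩ -
    simp [Fin.succAbove_succAbove_predAbove, Fin.predAbove_predAbove_succAbove]

theorem cobar_sq (F : PosetFunctor P) {n : ℕ} (ψ : cochain F n) :
    cobarDiff F (n + 1) (cobarDiff F n ψ) = 0 := by
  funext c
  rw [cobar_apply]
  rw [Finset.sum_congr rfl (fun i _ => by
    rw [push_cobar F ψ (chainFace i c) _ (c.2 (Fin.le_last (i.succAbove (Fin.last (n+1)))))])]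
  exact alt_sum_zero _ c

/-- append a point to a chain -/
def snocC {n : ℕ} (c : ChainP P n) (q : P) (h : c.1 (Fin.last n) ≤ q) : ChainP P (n + 1) :=
  ⟨Fin.snoc (α := fun _ => P) c.1 q, by
    intro i j hij
    induction j using Fin.lastCases with
    | last =>
      rw [Fin.snoc_last]
      induction i using Fin.lastCases with
      | last => rw [Fin.snoc_last]
      | cast i => rw [Fin.snoc_castSucc]; exact (c.2 (Fin.le_last i)).trans h
    | cast j =>
      induction i using Fin.lastCases with
      | last => exact absurd hij (not_le.2 (Fin.castSucc_lt_last j))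
      | cast i =>
        rw [Fin.snoc_castSucc, Fin.snoc_castSucc]; exact c.2 (Fin.castSucc_le_castSucc_iff.1 hij)⟩

theorem snocC_last {n : ℕ} (c : ChainP P n) (q : P) (h : c.1 (Fin.last n) ≤ q) :
    (snocC c q h).1 (Fin.last (n + 1)) = q := Fin.snoc_last (α := fun _ => P) _ _

theorem face_last_snocC {n : ℕ} (c : ChainP P n) (q : P) (h : c.1 (Fin.last n) ≤ q) :
    chainFace (Fin.last (n + 1)) (snocC c q h) = c := by
  apply Subtype.ext
  funext k
  change Fin.snoc (α := fun _ => P) c.1 q _ = _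
  rw [Fin.succAbove_last, Fin.snoc_castSucc]

theorem face_le {n : ℕ} (c : ChainP P (n + 1)) (i : Fin (n + 2)) :
    (chainFace i c).1 (Fin.last n) ≤ c.1 (Fin.last (n + 1)) :=
  c.2 (Fin.le_last (i.succAbove (Fin.last n)))

theorem face_castSucc_snocC {n : ℕ} (c : ChainP P (n + 1)) (q : P)
    (h : c.1 (Fin.last (n + 1)) ≤ q) (i : Fin (n + 2)) :
    chainFace i.castSucc (snocC c q h) = snocC (chainFace i c) q ((face_le c i).trans h) := by
  apply Subtype.ext
  funext k
  change Fin.snoc (α := fun _ => P) c.1 q _ = Fin.snoc (α := fun _ => P) (chainFace i c).1 q k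
  induction k using Fin.lastCases with
  | last =>
    rw [Fin.snoc_last, Fin.succAbove_of_le_castSucc _ _
      (Fin.castSucc_le_castSucc_iff.2 (Fin.le_last i)), Fin.succ_last, Fin.snoc_last]
  | cast k =>
    rw [Fin.snoc_castSucc, Fin.castSucc_succAbove_castSucc, Fin.snoc_castSucc]
    rfl

/-- evaluation of `Ker'` at a factor -/
def evK (G : GradedPoset P) (F : PosetFunctor P) (m : ℕ) {p : P} (q : degSet G p m) :
    (kerPrime G F m).obj p →+ F.obj q.1 :=
  AddMonoidHom.mk' (fun x => x q) (fun _ _ => rfl)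

theorem evK_map (G : GradedPoset P) (F : PosetFunctor P) (m : ℕ) {p p' : P} (h : p ≤ p')
    (q : degSet G p' m) (x : (kerPrime G F m).obj p) :
    evK G F m q ((kerPrime G F m).map h x) = evK G F m ⟨q.1, h.trans q.2.1, q.2.2⟩ x := rfl

theorem acyclic (G : GradedPoset P) (F : PosetFunctor P) (m n : ℕ)
    (ψ : cochain (kerPrime G F m) (n + 1)) (hψ : cobarDiff (kerPrime G F m) (n + 1) ψ = 0) :
    ∃ φ, cobarDiff (kerPrime G F m) n φ = ψ := by
  let φ : cochain (kerPrime G F m) n := fun c q =>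
    evK G F m (p := q.1) ⟨q.1, le_rfl, q.2.2⟩ (push (kerPrime G F m) ψ q.1 (snocC c q.1 q.2.1))
  have key : cobarDiff (kerPrime G F m) n φ = -((-1 : ℤ) ^ (n + 2) • ψ) := by
    funext c
    rw [cobar_apply]
    funext q
    have e1 : evK G F m (p := q.1) ⟨q.1, le_rfl, q.2.2⟩ (push (kerPrime G F m)
        (cobarDiff (kerPrime G F m) (n + 1) ψ) q.1 (snocC c q.1 q.2.1)) = 0 := by
      rw [hψ]
      rw [push_of _ _ _ _ (snocC_last c q.1 q.2.1).le]
      exact map_zero _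
    rw [push_cobar _ _ _ _ (snocC_last c q.1 q.2.1).le, Fin.sum_univ_castSucc, map_add,
      map_sum, face_last_snocC, map_zsmul, push_of _ _ _ _ q.2.1, evK_map] at e1
    change evK G F m q (∑ i : Fin (n + 2), ((-1 : ℤ) ^ (i : ℕ)) •
      push (kerPrime G F m) φ (c.1 (Fin.last (n + 1))) (chainFace i c)) =
        -((-1 : ℤ) ^ (n + 2) • evK G F m q (ψ c))
    rw [map_sum, eq_neg_iff_add_eq_zero]
    refine Eq.trans ?_ e1
    congr 1
    refine Finset.sum_congr rfl fun i _ => ?_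
    rw [map_zsmul, map_zsmul, push_of _ _ _ _ (face_le c i), evK_map, face_castSucc_snocC]
    rfl
  rcases neg_one_pow_eq_or ℤ (n + 2) with h | h
  · refine ⟨-φ, ?_⟩
    rw [map_neg, key, h, one_smul, neg_neg]
  · refine ⟨φ, ?_⟩
    rw [key, h, neg_smul, one_smul, neg_neg]

/-- cochain map induced by a natural transformation -/
def cmap {F F' : PosetFunctor P} (f : PosetHom F F') (n : ℕ) : cochain F n →+ cochain F' n :=
  AddMonoidHom.mk' (fun ψ c => f.app _ (ψ c)) (by intro a b; funext c; exact map_add (f.app _) _ _)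

theorem cmap_cobar {F F' : PosetFunctor P} (f : PosetHom F F') (n : ℕ) (ψ : cochain F n) :
    cmap f (n + 1) (cobarDiff F n ψ) = cobarDiff F' n (cmap f n ψ) := by
  funext c
  change f.app _ (cobarDiff F n ψ c) = _
  rw [cobar_apply, cobar_apply, map_sum]
  refine Finset.sum_congr rfl fun i _ => ?_
  rw [map_zsmul, push_of _ _ _ _ (face_le c i), push_of _ _ _ _ (face_le c i), ← f.naturality]
  rfl

theorem cmap_surj {F F' : PosetFunctor P} (f : PosetHom F F')
    (hf : ∀ p, Function.Surjective (f.app p)) (n : ℕ) : Function.Surjective (cmap f n) := by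
  intro ψ
  choose g hg using fun p => hf p
  exact ⟨fun c => g _ (ψ c), funext fun c => hg _ _⟩

theorem cmap_inj {F F' : PosetFunctor P} (f : PosetHom F F')
    (hf : ∀ p, Function.Injective (f.app p)) (n : ℕ) : Function.Injective (cmap f n) := by
  intro a b h
  funext c
  exact hf _ (congrFun h c)

theorem cmap_exact {F F' F'' : PosetFunctor P} (f : PosetHom F F') (g : PosetHom F' F'')
    (h : ∀ p, (g.app p).ker = (f.app p).range) (n : ℕ) (ψ : cochain F' n) :
    cmap g n ψ = 0 ↔ ∃ φ, cmap f n φ = ψ := by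
  constructor
  · intro h0
    have : ∀ c, ∃ x, f.app _ x = ψ c := fun c => by
      have : ψ c ∈ (g.app _).ker := congrFun h0 c
      rw [h] at this
      exact this
    choose φ hφ using this
    exact ⟨φ, funext hφ⟩
  · rintro ⟨φ, rfl⟩
    funext c
    have : f.app _ (φ c) ∈ (g.app (c.1 (Fin.last n))).ker := by rw [h]; exact ⟨_, rfl⟩
    exact this

theorem lambda_inj (G : GradedPoset P) (F : PosetFunctor P) (n : ℕ) (hF : IsCondensed G F n)
    (p : P) : Function.Injective ((lambdaNT G F n).app p) := by
  have key : ∀ k : ℕ, ∀ p : P, {q : P | p ≤ q}.ncard ≤ k → ∀ x : F.obj p,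
      (lambdaNT G F n).app p x = 0 → x = 0 := by
    intro k
    induction k with
    | zero =>
      intro p hp
      have : {q : P | p ≤ q}.ncard ≠ 0 := by
        exact Set.ncard_ne_zero_of_mem (show p ∈ {q : P | p ≤ q} from le_refl p) (G.finite_up p)
      omega
    | succ k ih =>
      intro p hp x hx
      rcases lt_trichotomy (G.deg p) n with h | h | h
      · exact hF.1 p h x
      · have := congrFun hx ⟨p, le_refl p, h⟩
        rw [← F.map_id p x]
        exact this
      · refine hF.2 p h x ?_
        intro q hq
        refine ih q ?_ _ ?_
        · have : {r : P | q ≤ r}.ncard < {r : P | p ≤ r}.ncard := by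
            apply Set.ncard_lt_ncard _ (G.finite_up p)
            refine ⟨fun r hr => hq.le.trans hr, fun hh => ?_⟩
            exact absurd (hh (show p ∈ {r : P | p ≤ r} from le_refl p)) (not_le_of_gt hq)
          omega
        · rw [← (lambdaNT G F n).naturality, hx, map_zero]
  rw [injective_iff_map_eq_zero]
  exact fun x hx => key _ p le_rfl x hx

theorem coh_connect {G : GradedPoset P} {J : P → ℕ → Set P} (S : CondensedSequence G J)
    (m i : ℕ) :
    Nonempty (((cobarDiff (S.F (m + 1)) i).ker ⧸
      ((cobarDiff (kerPrime G (S.F m) m) i).ker.map (cmap (S.pi m) i)).addSubgroupOf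
        (cobarDiff (S.F (m + 1)) i).ker) ≃+ cohomologyOf (S.F m) (i + 1)) :=
  connecting (cobarDiff (S.F m) i) (cobarDiff (S.F m) (i + 1))
    (cobarDiff (kerPrime G (S.F m) m) i) (cobarDiff (kerPrime G (S.F m) m) (i + 1))
    (cobarDiff (S.F (m + 1)) i)
    (cmap (lambdaNT G (S.F m) m) i) (cmap (lambdaNT G (S.F m) m) (i + 1))
    (cmap (lambdaNT G (S.F m) m) (i + 2)) (cmap (S.pi m) i) (cmap (S.pi m) (i + 1))
    (cmap_inj _ (lambda_inj G _ m (S.condensed m)) _)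
    (cmap_inj _ (lambda_inj G _ m (S.condensed m)) _)
    (cmap_surj _ (S.pi_surj m) _)
    (cmap_exact _ _ (S.pi_ker m) _) (cmap_exact _ _ (S.pi_ker m) _)
    (cobar_sq _) (cmap_cobar _ _) (cmap_cobar _ _) (cmap_cobar _ _)
    (acyclic G (S.F m) m i)

theorem coh_shift {G : GradedPoset P} {J : P → ℕ → Set P} (S : CondensedSequence G J)
    (m k : ℕ) :
    Nonempty (cohomologyOf (S.F (m + 1)) (k + 1) ≃+ cohomologyOf (S.F m) (k + 2)) := by
  obtain ⟨e⟩ := coh_connect S m (k + 1)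
  have h : (cobarDiff (kerPrime G (S.F m) m) (k + 1)).ker.map (cmap (S.pi m) (k + 1)) =
      cobarCoboundaries (S.F (m + 1)) (k + 1) := by
    ext ψ
    constructor
    · rintro ⟨b, hb, rfl⟩
      obtain ⟨φ, rfl⟩ := acyclic G (S.F m) m k b hb
      exact ⟨cmap (S.pi m) k φ, (cmap_cobar _ _ _).symm⟩
    · rintro ⟨φ, rfl⟩
      obtain ⟨b, rfl⟩ := cmap_surj _ (S.pi_surj m) _ φ
      exact ⟨cobarDiff _ k b, cobar_sq _ b, cmap_cobar _ _ _⟩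
  rw [h] at e
  exact ⟨e⟩

theorem coh_iter {G : GradedPoset P} {J : P → ℕ → Set P} (S : CondensedSequence G J)
    (k : ℕ) : ∀ m n : ℕ, n = m + k →
    Nonempty (cohomologyOf (S.F n) 1 ≃+ cohomologyOf (S.F m) (k + 1)) := by
  induction k with
  | zero => rintro m n rfl; exact ⟨AddEquiv.refl _⟩
  | succ k ih =>
    intro m n h
    obtain ⟨e⟩ := ih (m + 1) n (by omega)
    obtain ⟨e'⟩ := coh_shift S m k
    exact ⟨e.trans e'⟩

/-- constant 0-chain -/
def pt (p : P) : ChainP P 0 := ⟨fun _ => p, monotone_const⟩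

theorem eq_pt (c : ChainP P 0) : c = pt (c.1 (Fin.last 0)) := by
  apply Subtype.ext
  funext k
  exact congrArg c.1 (Fin.ext (by have := k.2; simp only [Fin.val_last]; omega))

theorem push_pt (F : PosetFunctor P) (ψ : cochain F 0) {p q : P} (h : p ≤ q) :
    push F ψ q (pt p) = F.map (p := p) h (ψ (pt p)) := push_of F ψ q (pt p) h

/-- a section viewed as a 0-cocycle -/
noncomputable def secCo (F : PosetFunctor P) : F.sections →+ (cobarDiff F 0).ker :=
  AddMonoidHom.mk' (fun s => ⟨fun c => s.1 (c.1 (Fin.last 0)), by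
    change cobarDiff F 0 _ = 0
    funext c
    rw [cobar_apply, Fin.sum_univ_two, push_of _ _ _ _ (face_le c 0), push_of _ _ _ _ (face_le c 1),
      s.2 _ _ (face_le c 0), s.2 _ _ (face_le c 1)]
    simp⟩) (fun _ _ => rfl)

theorem secCo_bij (F : PosetFunctor P) : Function.Bijective (secCo F) := by
  constructor
  · intro s t h
    apply Subtype.ext
    funext p
    exact congrFun (congrArg Subtype.val h) (pt p)
  · rintro ⟨ψ, hψ⟩
    have hψ' : cobarDiff F 0 ψ = 0 := hψ
    refine ⟨⟨fun p => ψ (pt p), ?_⟩, ?_⟩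
    · intro p q h
      have e := push_cobar F ψ (snocC (pt p) q h) q (snocC_last (pt p) q h).le
      rw [hψ', push_of _ _ _ _ (snocC_last (pt p) q h).le] at e
      have f0 : chainFace 0 (snocC (pt p) q h) = pt q := by
        rw [eq_pt (chainFace 0 _)]
        exact congrArg pt (snocC_last (pt p) q h)
      have f1 : chainFace 1 (snocC (pt p) q h) = pt p := face_last_snocC (pt p) q h
      rw [Fin.sum_univ_two, f0, f1, push_pt F ψ le_rfl, push_pt F ψ h,
        show F.map (le_refl q) (ψ (pt q)) = ψ (pt q) from F.map_id q (ψ (pt q))] at e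
      have e' : F.map (snocC_last (pt p) q h).le
        ((0 : cochain F 1) (snocC (pt p) q h)) = 0 := map_zero _
      rw [e'] at e
      simp only [Fin.val_zero, Fin.val_one, pow_zero, pow_one, one_smul, neg_smul] at e
      exact (eq_of_sub_eq_zero ((sub_eq_add_neg _ _).trans e.symm)).symm.trans (one_zsmul _)
    · apply Subtype.ext
      funext c
      have : ∀ c' : ChainP P 0, c' = pt (c.1 (Fin.last 0)) →
          push F ψ (c.1 (Fin.last 0)) c' = ψ (pt (c.1 (Fin.last 0))) := by
        rintro _ rfl
        exact push_last F ψ (pt (c.1 (Fin.last 0)))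
      exact (this c (eq_pt c)).symm.trans (push_last F ψ c)

section seq
variable {G : GradedPoset P} {J : P → ℕ → Set P} (S : CondensedSequence G J)

theorem dhat_mem (n : ℕ) (x : ∀ p, (S.F n).obj p) :
    dhat G n (S.pi n) x ∈ (S.F (n + 1)).sections := by
  intro p q h
  exact (S.pi n).naturality h _

theorem dhat_congr (n : ℕ) (x y : ∀ p, (S.F n).obj p) (h : ∀ p, G.deg p = n → x p = y p) :
    dhat G n (S.pi n) x = dhat G n (S.pi n) y := by
  funext p
  change (S.pi n).app p _ = (S.pi n).app p _
  congr 1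
  funext q
  exact h q.1 q.2.2

theorem dhat_sec (n : ℕ) (s : (S.F n).sections) : dhat G n (S.pi n) s.1 = 0 := by
  funext p
  have : (lambdaNT G (S.F n) n).app p (s.1 p) ∈ ((S.pi n).app p).ker := by
    rw [S.pi_ker]; exact ⟨_, rfl⟩
  refine Eq.trans ?_ this
  change (S.pi n).app p _ = (S.pi n).app p _
  congr 1
  funext q
  exact (s.2 p q.1 q.2.1).symm

theorem dhat_ker (n : ℕ) (x : ∀ p, (S.F n).obj p) (h : dhat G n (S.pi n) x = 0) :
    ∃ s : (S.F n).sections, ∀ p, G.deg p = n → s.1 p = x p := by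
  have h1 : ∀ p, ∃ y, (lambdaNT G (S.F n) n).app p y = fun q : degSet G p n => x q.1 := by
    intro p
    have : (show (kerPrime G (S.F n) n).obj p from fun q : degSet G p n => x q.1) ∈ ((S.pi n).app p).ker :=
      congrFun h p
    rw [S.pi_ker] at this
    exact this
  choose s hs using h1
  refine ⟨⟨s, ?_⟩, ?_⟩
  · intro p q hpq
    apply lambda_inj G _ n (S.condensed n)
    rw [← (lambdaNT G (S.F n) n).naturality, hs, hs]
    rfl
  · intro p hp
    have := congrFun (hs p) ⟨p, le_refl p, hp⟩
    exact ((S.F n).map_id p (s p)).symm.trans this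

theorem coh_succ (n : ℕ) : ∃ Φ : (S.F (n + 1)).sections →+ cohomologyOf (constZ P) (n + 1),
    Function.Surjective Φ ∧
      ∀ s, Φ s = 0 ↔ ∃ x : ∀ p, (S.F n).obj p, dhat G n (S.pi n) x = s.1 := by
  rw [← S.F_zero]
  obtain ⟨e⟩ := coh_iter S n 0 n (by omega)
  obtain ⟨e'⟩ := coh_connect S n 0
  refine ⟨(e'.trans e).toAddMonoidHom.comp ((QuotientAddGroup.mk' _).comp (secCo _)), ?_, ?_⟩
  · exact (e'.trans e).surjective.comp
      ((QuotientAddGroup.mk'_surjective _).comp (secCo_bij _).2)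
  · intro s
    change (e'.trans e) (QuotientAddGroup.mk (secCo _ s)) = 0 ↔ _
    rw [(e'.trans e).map_eq_zero_iff, QuotientAddGroup.eq_zero_iff, AddSubgroup.mem_addSubgroupOf]
    constructor
    · rintro ⟨ψ, hψ, hs⟩
      obtain ⟨t, ht⟩ := (secCo_bij _).2 ⟨ψ, hψ⟩
      have ht' : (secCo _ t).1 = ψ := congrArg Subtype.val ht
      classical
      refine ⟨fun p => if hp : G.deg p = n then t.1 p ⟨p, le_refl p, hp⟩ else 0, ?_⟩
      funext p
      have e1 := congrFun hs (pt p)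
      rw [← ht'] at e1
      refine Eq.trans ?_ e1
      change (S.pi n).app p _ = (S.pi n).app p (t.1 p)
      congr 1
      funext q
      refine (dif_pos q.2.2).trans ?_
      rw [← t.2 p q.1 q.2.1]
      rfl
    · rintro ⟨x, hx⟩
      let t : (kerPrime G (S.F n) n).sections := ⟨fun p q => x q.1, fun p q h => rfl⟩
      refine ⟨(secCo _ t).1, (secCo _ t).2, ?_⟩
      funext c
      exact congrFun hx (c.1 (Fin.last 0))

theorem coh_zero : ∃ Φ : (S.F 0).sections →+ cohomologyOf (constZ P) 0,
    Function.Surjective Φ ∧ ∀ s, Φ s = 0 ↔ s = 0 := by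
  rw [← S.F_zero]
  refine ⟨(QuotientAddGroup.mk' _).comp (secCo _), ?_, ?_⟩
  · exact (QuotientAddGroup.mk'_surjective _).comp (secCo_bij _).2
  · intro s
    change (QuotientAddGroup.mk (secCo _ s) : _ ⧸ ((cobarCoboundaries (S.F 0) 0).addSubgroupOf
      (cobarDiff (S.F 0) 0).ker)) = 0 ↔ _
    rw [QuotientAddGroup.eq_zero_iff, AddSubgroup.mem_addSubgroupOf]
    rw [← map_eq_zero_iff (secCo _) (secCo_bij _).1]
    change _ ∈ (⊥ : AddSubgroup _) ↔ _
    rw [AddSubgroup.mem_bot]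
    exact ⟨fun h => Subtype.ext h, fun h => congrArg Subtype.val h⟩

theorem ext_mem {A : P → Type} [∀ i, AddCommGroup (A i)] (T : Set P) (x : ∀ i : T, A i.1)
    {p : P} (h : p ∈ T) : extendZero T x p = x ⟨p, h⟩ := by
  classical
  exact dif_pos h

theorem ext_not_mem {A : P → Type} [∀ i, AddCommGroup (A i)] (T : Set P) (x : ∀ i : T, A i.1)
    {p : P} (h : p ∉ T) : extendZero T x p = 0 := by
  classical
  exact dif_neg h

variable {K : ℕ → Set P} (hK : IsGCF G S.F S.pi K)

theorem dhat_split (n : ℕ) (hKn : K n ⊆ obSet G n) (x : ∀ p, (S.F n).obj p) :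
    dhat G n (S.pi n) (extendZero (K n) (restrictTo (K n) x)) +
      dhat G n (S.pi n) (extendZero (obSet G n \ K n) (restrictTo (obSet G n \ K n) x)) =
    dhat G n (S.pi n) x := by
  rw [← map_add]
  apply dhat_congr
  intro p hp
  rw [Pi.add_apply]
  by_cases h : p ∈ K n
  · rw [ext_mem _ _ h, ext_not_mem _ _ (fun h' => h'.2 h), add_zero]; rfl
  · rw [ext_not_mem _ _ h, ext_mem _ _ (show p ∈ obSet G n \ K n from ⟨hp, h⟩), zero_add]; rfl

theorem sec_split (n : ℕ) (hKn : K n ⊆ obSet G n) (s : (S.F n).sections) :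
    dK G S.F S.pi K n (restrictTo (K n) s.1) =
      wMap G S.F S.pi K n (-restrictTo (obSet G n \ K n) s.1) := by
  have h := dhat_split S n hKn s.1
  rw [dhat_sec] at h
  rw [map_neg]
  have h2 := congrArg (restrictTo (K (n + 1))) h
  rw [map_add, map_zero] at h2
  exact eq_neg_of_add_eq_zero_left h2

include hK in
theorem sec_ext (n : ℕ) (s t : (S.F n).sections)
    (h : restrictTo (K n) s.1 = restrictTo (K n) t.1) : s = t := hK.2.1 n h

include hK in
theorem w_inj (n : ℕ) : Function.Injective (wMap G S.F S.pi K n) := by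
  rw [injective_iff_map_eq_zero]
  intro x hx
  have h1 : (⟨_, dhat_mem S n (extendZero (obSet G n \ K n) x)⟩ : (S.F (n + 1)).sections) = 0 :=
    sec_ext S hK _ _ _ hx
  obtain ⟨s, hs⟩ := dhat_ker S n _ (congrArg Subtype.val h1)
  have h2 : s = 0 := by
    apply sec_ext S hK
    funext p
    have h3 := hs p.1 (hK.1 n p.2)
    rw [ext_not_mem _ _ (fun h' => h'.2 p.2)] at h3
    exact h3
  funext p
  have h3 := hs p.1 p.2.1
  rw [ext_mem _ _ p.2, h2] at h3
  exact h3.symm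

/-- The projection onto `B_n`. -/
noncomputable def qmap (G : GradedPoset P) (F : ℕ → PosetFunctor P)
    (π : ∀ n : ℕ, PosetHom (kerPrime G (F n) n) (F (n + 1))) (K : ℕ → Set P) :
    ∀ n : ℕ, (∀ p : ↥(K n), (F n).obj p.1) →+ BK G F π K n
  | 0 => AddMonoidHom.id (∀ p : ↥(K 0), (F 0).obj p.1)
  | n + 1 => QuotientAddGroup.mk' (wMap G F π K n).range

theorem qmap_surj (n : ℕ) : Function.Surjective (qmap G S.F S.pi K n) := by
  cases n with
  | zero => exact fun x => ⟨x, rfl⟩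
  | succ n => exact QuotientAddGroup.mk'_surjective _

theorem qmap_succ_zero (n : ℕ) (y : ∀ p : ↥(K (n + 1)), (S.F (n + 1)).obj p.1) :
    qmap G S.F S.pi K (n + 1) y = 0 ↔ ∃ x, wMap G S.F S.pi K n x = y :=
  (QuotientAddGroup.eq_zero_iff y)

include hK in
theorem q_dK_ker (n : ℕ) (y : ∀ p : ↥(K n), (S.F n).obj p.1)
    (h : qmap G S.F S.pi K (n + 1) (dK G S.F S.pi K n y) = 0) :
    ∃ s : (S.F n).sections, restrictTo (K n) s.1 = y := by
  obtain ⟨x, hx⟩ := (qmap_succ_zero S n _).1 h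
  have h1 : (⟨_, dhat_mem S n (extendZero (K n) y - extendZero (obSet G n \ K n) x)⟩ :
      (S.F (n + 1)).sections) = 0 := by
    apply sec_ext S hK
    change restrictTo (K (n + 1)) (dhat G n (S.pi n) _) = _
    rw [map_sub, map_sub]
    exact sub_eq_zero.2 hx.symm
  obtain ⟨s, hs⟩ := dhat_ker S n _ (congrArg Subtype.val h1)
  refine ⟨s, ?_⟩
  funext p
  have h3 := hs p.1 (hK.1 n p.2)
  rw [Pi.sub_apply, ext_not_mem (obSet G n \ K n) _ (fun h' => h'.2 p.2), ext_mem _ _ p.2, sub_zero] at h3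
  exact h3

include hK in
theorem q_dK_sec (n : ℕ) (s : (S.F n).sections) :
    qmap G S.F S.pi K (n + 1) (dK G S.F S.pi K n (restrictTo (K n) s.1)) = 0 := by
  rw [qmap_succ_zero, sec_split S n (hK.1 n)]
  exact ⟨_, rfl⟩

include hK in
theorem q_dK_of_q (n : ℕ) (y : ∀ p : ↥(K n), (S.F n).obj p.1)
    (h : qmap G S.F S.pi K n y = 0) :
    qmap G S.F S.pi K (n + 1) (dK G S.F S.pi K n y) = 0 := by
  cases n with
  | zero =>
    have : y = 0 := h
    rw [this, map_zero, map_zero]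
  | succ n =>
    obtain ⟨x, rfl⟩ := (qmap_succ_zero S n _).1 h
    exact q_dK_sec S hK (n + 1) ⟨_, dhat_mem S n (extendZero (obSet G n \ K n) x)⟩

include hK in
theorem exists_omega : ∃ Ω : ∀ n : ℕ, BK G S.F S.pi K n →+ BK G S.F S.pi K (n + 1),
    ∀ n x, Ω n (qmap G S.F S.pi K n x) = qmap G S.F S.pi K (n + 1) (dK G S.F S.pi K n x) := by
  refine ⟨fun n => (qmap G S.F S.pi K n).liftOfRightInverse (Function.surjInv (qmap_surj S n))
    (Function.rightInverse_surjInv (qmap_surj S n)) ⟨(qmap G S.F S.pi K (n + 1)).comp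
      (dK G S.F S.pi K n), fun y hy => q_dK_of_q S hK n y hy⟩, fun n x => ?_⟩
  exact AddMonoidHom.liftOfRightInverse_comp_apply _ _ _ _ x

section omega
variable (Ω : ∀ n : ℕ, BK G S.F S.pi K n →+ BK G S.F S.pi K (n + 1))
    (hΩ : ∀ n x, Ω n (qmap G S.F S.pi K n x) = qmap G S.F S.pi K (n + 1) (dK G S.F S.pi K n x))

include hΩ hK in
theorem omega_sq (n : ℕ) : (Ω (n + 1)).comp (Ω n) = 0 := by
  ext b
  obtain ⟨y, rfl⟩ := qmap_surj S n b
  change Ω (n + 1) (Ω n _) = 0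
  rw [hΩ, hΩ]
  exact q_dK_sec S hK (n + 1) ⟨_, dhat_mem S n (extendZero (K n) y)⟩

/-- sections map to the kernel of `Ω`. -/
noncomputable def secB (n : ℕ) : (S.F n).sections →+ BK G S.F S.pi K n :=
  (qmap G S.F S.pi K n).comp ((restrictTo (K n)).comp (S.F n).sections.subtype)

include hΩ hK in
theorem omega_secB (n : ℕ) (s : (S.F n).sections) : Ω n (secB S (K := K) n s) = 0 := by
  change Ω n (qmap G S.F S.pi K n _) = 0
  rw [hΩ]
  exact q_dK_sec S hK n s

include hΩ hK in
theorem omega_ker (n : ℕ) (b : BK G S.F S.pi K n) (h : Ω n b = 0) :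
    ∃ s, secB S (K := K) n s = b := by
  obtain ⟨y, rfl⟩ := qmap_surj S n b
  rw [hΩ] at h
  obtain ⟨s, hs⟩ := q_dK_ker S hK n y h
  exact ⟨s, congrArg (qmap G S.F S.pi K n) hs⟩

include hΩ hK in
theorem omega_range (n : ℕ) (s : (S.F (n + 1)).sections) :
    secB S (K := K) (n + 1) s ∈ (Ω n).range ↔
      ∃ x : ∀ p, (S.F n).obj p, dhat G n (S.pi n) x = s.1 := by
  constructor
  · rintro ⟨b, hb⟩
    obtain ⟨y, rfl⟩ := qmap_surj S n b
    rw [hΩ] at hb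
    have h1 : qmap G S.F S.pi K (n + 1) (restrictTo (K (n + 1)) s.1 - dK G S.F S.pi K n y) = 0 := by
      rw [map_sub, hb]
      exact sub_self _
    obtain ⟨x, hx⟩ := (qmap_succ_zero S n _).1 h1
    refine ⟨extendZero (K n) y + extendZero (obSet G n \ K n) x, ?_⟩
    refine congrArg Subtype.val (sec_ext S hK (n + 1)
      ⟨_, dhat_mem S n (extendZero (K n) y + extendZero (obSet G n \ K n) x)⟩ s ?_)
    change restrictTo (K (n + 1)) (dhat G n (S.pi n) _) = _
    rw [map_add, map_add]
    exact (congrArg (dK G S.F S.pi K n y + ·) hx).trans (add_sub_cancel _ _)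
  · rintro ⟨x, hx⟩
    refine ⟨qmap G S.F S.pi K n (restrictTo (K n) x), ?_⟩
    rw [hΩ]
    change _ = qmap G S.F S.pi K (n + 1) (restrictTo (K (n + 1)) s.1)
    rw [← hx, ← dhat_split S n (hK.1 n) x, map_add, map_add]
    have : qmap G S.F S.pi K (n + 1) (restrictTo (K (n + 1)) (dhat G n (S.pi n)
      (extendZero (obSet G n \ K n) (restrictTo (obSet G n \ K n) x)))) = 0 :=
      (qmap_succ_zero S n _).2 ⟨_, rfl⟩
    rw [this, add_zero]
    rfl

include hΩ hK in
theorem omega_coh_zero : Nonempty (↥(Ω 0).ker ≃+ cohomologyOf (constZ P) 0) := by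
  obtain ⟨Φ, hΦ, hΦ0⟩ := coh_zero S
  refine equiv_of_ker ((secB S (K := K) 0).codRestrict (Ω 0).ker (omega_secB S hK Ω hΩ 0)) Φ ?_ hΦ ?_
  · rintro ⟨b, hb⟩
    obtain ⟨s, hs⟩ := omega_ker S hK Ω hΩ 0 b hb
    exact ⟨s, Subtype.ext hs⟩
  · intro s
    rw [hΦ0]
    constructor
    · intro h
      exact sec_ext S hK 0 _ _ (congrArg Subtype.val h)
    · rintro rfl
      exact map_zero _

include hΩ hK in
theorem omega_coh_succ (n : ℕ) : Nonempty
        ((↥(Ω (n + 1)).ker ⧸ ((Ω n).range.addSubgroupOf (Ω (n + 1)).ker)) ≃+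
          cohomologyOf (constZ P) (n + 1)) := by
  obtain ⟨Φ, hΦ, hΦ0⟩ := coh_succ S n
  refine equiv_of_ker ((QuotientAddGroup.mk' _).comp
    ((secB S (K := K) (n + 1)).codRestrict (Ω (n + 1)).ker (omega_secB S hK Ω hΩ (n + 1)))) Φ
    ((QuotientAddGroup.mk'_surjective _).comp ?_) hΦ ?_
  · rintro ⟨b, hb⟩
    obtain ⟨s, hs⟩ := omega_ker S hK Ω hΩ (n + 1) b hb
    exact ⟨s, Subtype.ext hs⟩
  · intro s
    rw [hΦ0, ← omega_range S hK Ω hΩ]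
    change (QuotientAddGroup.mk _ : ↥(Ω (n + 1)).ker ⧸ ((Ω n).range.addSubgroupOf (Ω (n + 1)).ker))
      = 0 ↔ _
    rw [QuotientAddGroup.eq_zero_iff, AddSubgroup.mem_addSubgroupOf]
    rfl

end omega

theorem pi_rank (n : ℕ) (T : Set P) (hT : T.Finite) (hTn : T ⊆ obSet G n) (T' : Finset P)
    (hT' : ∀ p, p ∈ T' ↔ p ∈ T) :
    Module.Free ℤ (∀ p : T, (S.F n).obj p.1) ∧ Module.Finite ℤ (∀ p : T, (S.F n).obj p.1) ∧
    (Module.finrank ℤ (∀ p : T, (S.F n).obj p.1) : ℤ) = ∑ p ∈ T', Rnum G n p := by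
  have hf : Fintype T := hT.fintype
  have h1 : ∀ p : T, Module.Free ℤ ((S.F n).obj p.1) := fun p => (S.free n p.1).1
  have h2 : ∀ p : T, Module.Finite ℤ ((S.F n).obj p.1) := fun p => (S.free n p.1).2
  refine ⟨inferInstance, inferInstance, ?_⟩
  have h3 := Module.finrank_pi_fintype ℤ (M := fun p : T => (S.F n).obj p.1)
  refine (congrArg (Nat.cast : ℕ → ℤ) h3).trans ?_
  rw [Nat.cast_sum, Finset.sum_subtype T' hT' (Rnum G n)]
  exact Finset.sum_congr rfl fun p _ => S.rank_eq n p.1 (hTn p.2).ge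

theorem quot_rank {A B : Type} [AddCommGroup A] [AddCommGroup B] [Module.Finite ℤ B] (f : A →+ B)
    (hf : Function.Injective f) :
    Module.finrank ℤ (B ⧸ f.range) + Module.finrank ℤ A = Module.finrank ℤ B := by
  let N : Submodule ℤ B := LinearMap.range f.toIntLinearMap
  have e1 := (LinearEquiv.ofInjective f.toIntLinearMap hf).finrank_eq
  have e2 := Submodule.finrank_quotient_add_finrank N
  rw [e1, ← e2]
  congr 1

include hK in
theorem B_rank (hfin : ∀ i : ℤ, {p : P | G.deg p = i}.Finite) (n : ℕ) :
    Module.Free ℤ (BK G S.F S.pi K n) ∧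
        (Module.finrank ℤ (BK G S.F S.pi K n) : ℤ) = bettiK G hfin K n := by
  have hm : ∀ n p, p ∈ KFinset G hfin K n ↔ p ∈ K n := by
    intro n p
    rw [KFinset, Set.Finite.mem_toFinset]
    exact ⟨fun h => h.2, fun h => ⟨hK.1 n h, h⟩⟩
  have hY := fun n => pi_rank S n (K n) ((hfin n).subset (hK.1 n)) (hK.1 n) _ (hm n)
  cases n with
  | zero => exact ⟨(hY 0).1, (hY 0).2.2⟩
  | succ n =>
    refine ⟨hK.2.2 n, ?_⟩
    classical
    have hW := pi_rank S n (obSet G n \ K n) ((hfin n).subset Set.sdiff_subset) Set.sdiff_subset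
      (obFinset G hfin n \ KFinset G hfin K n) (by
        intro p
        rw [Finset.mem_sdiff, hm, obFinset, Set.Finite.mem_toFinset]
        rfl)
    have hs : ∑ p ∈ obFinset G hfin n \ KFinset G hfin K n, Rnum G n p +
        ∑ p ∈ KFinset G hfin K n, Rnum G n p = ∑ p ∈ obFinset G hfin n, Rnum G n p := by
      apply Finset.sum_sdiff
      intro p hp
      rw [obFinset, Set.Finite.mem_toFinset]
      exact hK.1 n ((hm n p).1 hp)
    have := (hY (n + 1)).2.1
    have hq := quot_rank (wMap G S.F S.pi K n) (w_inj S hK n)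
    have hq' : (Module.finrank ℤ (BK G S.F S.pi K (n + 1)) : ℤ) + Module.finrank ℤ
      (∀ p : ↥(obSet G n \ K n), (S.F n).obj p.1) = Module.finrank ℤ
      (∀ p : ↥(K (n + 1)), (S.F (n + 1)).obj p.1) := by exact_mod_cast hq
    rw [hW.2.2, (hY (n + 1)).2.2] at hq'
    change _ = (∑ p ∈ KFinset G hfin K n, Rnum G n p) - (∑ p ∈ obFinset G hfin n, Rnum G n p) +
        ∑ p ∈ KFinset G hfin K (n + 1), Rnum G (n + 1) p
    linarith

end seq

end T55

/-- **Theorem 5.5.** Let `𝒫` be a graded poset for which there exists an adequate local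
covering family and a global covering family `𝒦`. Then there exists a co-chain complex
`0 → B_0^𝒦 → B_1^𝒦 → B_2^𝒦 → …` with each `B_n^𝒦` a free abelian group of rank
`b_n^𝒦` and differentials `Ω_n` induced by the differentials `d_n`, whose cohomology is
`H^*(𝒫; ℤ)`. -/
theorem theorem_5_5 {P : Type} [PartialOrder P] (G : GradedPoset P) (J : P → ℕ → Set P)
    (hJ : IsAdequate G J) (S : CondensedSequence G J)
    (hfin : ∀ i : ℤ, {p : P | G.deg p = i}.Finite)
    (K : ℕ → Set P) (hK : IsGCF G S.F S.pi K) :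
    ∃ Ω : ∀ n : ℕ, BK G S.F S.pi K n →+ BK G S.F S.pi K (n + 1),
      (∀ x : ∀ p : ↥(K 0), (S.F 0).obj p.1,
        Ω 0 x = QuotientAddGroup.mk (dK G S.F S.pi K 0 x)) ∧
      (∀ (n : ℕ) (x : ∀ p : ↥(K (n + 1)), (S.F (n + 1)).obj p.1),
        Ω (n + 1) (QuotientAddGroup.mk x) = QuotientAddGroup.mk (dK G S.F S.pi K (n + 1) x)) ∧
      (∀ n : ℕ, (Ω (n + 1)).comp (Ω n) = 0) ∧
      (∀ n : ℕ, Module.Free ℤ (BK G S.F S.pi K n) ∧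
        (Module.finrank ℤ (BK G S.F S.pi K n) : ℤ) = bettiK G hfin K n) ∧
      Nonempty (↥(Ω 0).ker ≃+ cohomologyOf (constZ P) 0) ∧
      ∀ n : ℕ, Nonempty
        ((↥(Ω (n + 1)).ker ⧸ ((Ω n).range.addSubgroupOf (Ω (n + 1)).ker)) ≃+
          cohomologyOf (constZ P) (n + 1)) := by
  obtain ⟨Ω, hΩ⟩ := T55.exists_omega S hK
  exact ⟨Ω, fun x => hΩ 0 x, fun n x => hΩ (n + 1) x, T55.omega_sq S hK Ω hΩ,
    T55.B_rank S hK hfin, T55.omega_coh_zero S hK Ω hΩ, T55.omega_coh_succ S hK Ω hΩ⟩
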